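/- There exists a constant C > 0 such that for every prime p with p ≡ 3 (mod 4) and every natural number t with t ≥ C·p·ln p, and for every i ∈ F_p, the total variation distance between the distribution of the random walk after t steps started at i and π is at most 1/(2e): (1/2)·∑_{j ∈ F_p} |(A^t)(i,j) − π(j)| ≤ 1/(2e). In particular, the mixing time of the random walk by the unit circle is O(p·ln p). -/

import Mathlib

open Finset

/-- The circle of quadrance `K` centered at the origin in `F_p × F_p`. -/
def circ (p : ℕ) [NeZero p] (K : ZMod p) : Finset (ZMod p × ZMod p) :=
  Finset.univ.filter (fun v => v.1 ^ 2 + v.2 ^ 2 = K)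

/-- `N_{ij}^k`: the number of pairs `(a, b)` with `a ∈ C_i`, `b ∈ C_j`, `a + b ∈ C_k`. -/
def Ncirc (p : ℕ) [NeZero p] (i j k : ZMod p) : ℕ :=
  ((circ p i ×ˢ circ p j).filter (fun ab => ab.1 + ab.2 ∈ circ p k)).card

/-- The random-walk kernel of the unit circle: `A(i,j) = N_{i1}^j / (|C_i|·|C_1|)`. -/
noncomputable def kerA (p : ℕ) [NeZero p] : Matrix (ZMod p) (ZMod p) ℝ :=
  fun i j => (Ncirc p i 1 j : ℝ) / (((circ p i).card : ℝ) * ((circ p 1).card : ℝ))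

/-- The stationary distribution: `π(0) = 1/p²`, `π(j) = (p+1)/p²` for `j ≠ 0`. -/
noncomputable def piDist (p : ℕ) [NeZero p] (j : ZMod p) : ℝ :=
  if j = 0 then 1 / (p : ℝ) ^ 2 else ((p : ℝ) + 1) / (p : ℝ) ^ 2


section General

variable {ι : Type*} [Fintype ι] [DecidableEq ι]

/-- Weighted Hilbert-Schmidt norm (squared). -/
noncomputable def hsW (w : ι → ℝ) (P : Matrix ι ι ℝ) : ℝ :=
  ∑ i, ∑ j, w i * (P i j) ^ 2 / w j

lemma hsW_mul (w : ι → ℝ) (hw : ∀ i, 0 < w i) (P Q : Matrix ι ι ℝ) :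
    hsW w (P * Q) ≤ hsW w P * hsW w Q := by
  have key : ∀ i j, ((P * Q) i j) ^ 2 ≤ (∑ k, P i k ^ 2 / w k) * (∑ k, w k * Q k j ^ 2) := by
    intro i j
    rw [Matrix.mul_apply]
    apply Finset.sum_sq_le_sum_mul_sum_of_sq_eq_mul
    · intro k _
      have := hw k
      positivity
    · intro k _
      have := hw k
      positivity
    · intro k _
      have := (hw k).ne'
      field_simp
  have hP : hsW w P = ∑ i, w i * ∑ k, P i k ^ 2 / w k := by
    unfold hsW
    simp_rw [Finset.mul_sum, mul_div_assoc]
  have hQ : hsW w Q = ∑ j, (∑ k, w k * Q k j ^ 2) / w j := by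
    unfold hsW
    rw [Finset.sum_comm]
    simp_rw [Finset.sum_div]
  rw [hP, hQ, Finset.sum_mul_sum]
  unfold hsW
  refine Finset.sum_le_sum fun i _ => Finset.sum_le_sum fun j _ => ?_
  calc w i * ((P * Q) i j) ^ 2 / w j
      ≤ w i * ((∑ k, P i k ^ 2 / w k) * (∑ k, w k * Q k j ^ 2)) / w j := by
        have h1 := hw i
        have h2 := hw j
        have h3 := key i j
        gcongr
    _ = _ := by ring

lemma hsW_nonneg (w : ι → ℝ) (hw : ∀ i, 0 < w i) (P : Matrix ι ι ℝ) : 0 ≤ hsW w P :=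
  Finset.sum_nonneg fun i _ => Finset.sum_nonneg fun j _ => by
    have h1 := hw i
    have h2 := hw j
    positivity

lemma hsW_pow (w : ι → ℝ) (hw : ∀ i, 0 < w i) (P : Matrix ι ι ℝ) (t : ℕ) :
    hsW w (P ^ (t + 1)) ≤ hsW w P ^ (t + 1) := by
  induction t with
  | zero => simp
  | succ n ih =>
    rw [pow_succ P, pow_succ (hsW w P)]
    exact (hsW_mul w hw _ _).trans
      (mul_le_mul_of_nonneg_right ih (hsW_nonneg w hw P))

lemma row_le (w : ι → ℝ) (hw : ∀ i, 0 < w i) (hs : ∑ i, w i = 1) (P : Matrix ι ι ℝ) (i : ι) :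
    w i * (∑ j, |P i j|) ^ 2 ≤ hsW w P := by
  have h1 : (∑ j, |P i j|) ^ 2 ≤ (∑ j, P i j ^ 2 / w j) * ∑ j, w j := by
    apply Finset.sum_sq_le_sum_mul_sum_of_sq_eq_mul
    · intro k _
      have := hw k
      positivity
    · intro k _
      exact (hw k).le
    · intro k _
      have := (hw k).ne'
      rw [sq_abs]
      field_simp
  rw [hs, mul_one] at h1
  calc w i * (∑ j, |P i j|) ^ 2 ≤ w i * ∑ j, P i j ^ 2 / w j :=
        mul_le_mul_of_nonneg_left h1 (hw i).le
    _ = ∑ j, w i * P i j ^ 2 / w j := by simp_rw [Finset.mul_sum, mul_div_assoc]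
    _ ≤ hsW w P := by
        unfold hsW
        refine Finset.single_le_sum (f := fun i => ∑ j, w i * P i j ^ 2 / w j) ?_
          (Finset.mem_univ i)
        intro k _
        refine Finset.sum_nonneg fun j _ => ?_
        have h1 := hw k
        have h2 := hw j
        positivity

lemma pow_sub_proj (A Q : Matrix ι ι ℝ) (h1 : A * Q = Q) (h2 : Q * A = Q) (h3 : Q * Q = Q)
    (t : ℕ) : (A - Q) ^ (t + 1) = A ^ (t + 1) - Q := by
  have h4 : ∀ n : ℕ, A ^ n * Q = Q := by
    intro n
    induction n with
    | zero => simp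
    | succ n ih => rw [pow_succ, mul_assoc, h1, ih]
  induction t with
  | zero => simp
  | succ n ih =>
    rw [pow_succ, ih, sub_mul, mul_sub, mul_sub, h4, h2, h3, ← pow_succ]
    simp

end General

section Circle

variable {p : ℕ} [Fact p.Prime]

lemma mem_circ (K : ZMod p) (v : ZMod p × ZMod p) : v ∈ circ p K ↔ v.1 ^ 2 + v.2 ^ 2 = K := by
  simp [circ]

lemma sq_add_sq_zero (hp : p % 4 = 3) (x y : ZMod p) (h : x ^ 2 + y ^ 2 = 0) : x = 0 ∧ y = 0 := by
  by_cases hy : y = 0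
  · subst hy
    simpa using h
  · exfalso
    have : (x / y) ^ 2 = -1 := by
      field_simp
      linear_combination h
    exact ZMod.mod_four_ne_three_of_sq_eq_neg_one this hp

lemma circ_zero_card (hp : p % 4 = 3) : (circ p 0).card = 1 := by
  rw [Finset.card_eq_one]
  refine ⟨(0, 0), ?_⟩
  ext ⟨x, y⟩
  rw [mem_circ]
  simp only [Finset.mem_singleton, Prod.mk.injEq]
  constructor
  · exact sq_add_sq_zero hp x y
  · rintro ⟨rfl, rfl⟩
    simp

lemma circ_card_le (i j : ZMod p) (hi : i ≠ 0) (hj : j ≠ 0) :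
    (circ p i).card ≤ (circ p j).card := by
  obtain ⟨a, b, hab⟩ := ZMod.sq_add_sq p (j / i)
  have hab0 : a ^ 2 + b ^ 2 ≠ 0 := by
    rw [hab]
    exact div_ne_zero hj hi
  apply Finset.card_le_card_of_injOn (fun v => (a * v.1 - b * v.2, a * v.2 + b * v.1))
  · intro v hv
    have hv' := (mem_circ i v).1 hv
    apply (mem_circ j _).2
    have : (a ^ 2 + b ^ 2) * i = j := by
      rw [hab]
      field_simp
    rw [← this, ← hv']
    ring
  · rintro ⟨x, y⟩ _ ⟨u, v⟩ _ h
    simp only [Prod.mk.injEq] at h ⊢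
    obtain ⟨h1, h2⟩ := h
    constructor
    · apply mul_left_cancel₀ hab0
      linear_combination a * h1 + b * h2
    · apply mul_left_cancel₀ hab0
      linear_combination a * h2 - b * h1

lemma circ_card (hp : p % 4 = 3) (i : ZMod p) (hi : i ≠ 0) : (circ p i).card = p + 1 := by
  have hsum : ∑ k : ZMod p, (circ p k).card = p ^ 2 := by
    have := Finset.card_eq_sum_card_fiberwise (s := (Finset.univ : Finset (ZMod p × ZMod p)))
      (t := (Finset.univ : Finset (ZMod p))) (f := fun v => v.1 ^ 2 + v.2 ^ 2)
      (by intro x _; simp)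
    rw [Finset.card_univ, Fintype.card_prod, ZMod.card] at this
    rw [pow_two, this]
    rfl
  have h2 : ∀ k ∈ (Finset.univ : Finset (ZMod p)).erase 0, (circ p k).card = (circ p i).card := by
    intro k hk
    have hk0 : k ≠ 0 := (Finset.mem_erase.1 hk).1
    exact le_antisymm (circ_card_le k i hk0 hi) (circ_card_le i k hi hk0)
  rw [← Finset.add_sum_erase _ _ (Finset.mem_univ (0 : ZMod p)), Finset.sum_congr rfl h2,
    circ_zero_card hp, Finset.sum_const, Finset.card_erase_of_mem (Finset.mem_univ _),
    Finset.card_univ, ZMod.card, smul_eq_mul] at hsum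
  have hp2 : 2 ≤ p := (Fact.out : p.Prime).two_le
  obtain ⟨q, rfl⟩ : ∃ q, p = q + 1 := ⟨p - 1, by omega⟩
  simp only [Nat.add_sub_cancel] at hsum
  have : q * (circ (q + 1) i).card = q * (q + 1 + 1) := by
    nlinarith
  exact Nat.eq_of_mul_eq_mul_left (by omega) this

lemma piDist_eq (hp : p % 4 = 3) (i : ZMod p) :
    piDist p i = ((circ p i).card : ℝ) / (p : ℝ) ^ 2 := by
  unfold piDist
  split_ifs with h
  · subst h
    rw [circ_zero_card hp]
    simp
  · rw [circ_card hp i h]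
    push_cast
    rfl

lemma card_pos (hp : p % 4 = 3) (i : ZMod p) : 0 < (circ p i).card := by
  by_cases h : i = 0
  · subst h
    rw [circ_zero_card hp]
    simp
  · rw [circ_card hp i h]
    simp

lemma piDist_pos (hp : p % 4 = 3) (i : ZMod p) : 0 < piDist p i := by
  rw [piDist_eq hp]
  have h1 : 0 < ((circ p i).card : ℝ) := by exact_mod_cast card_pos hp i
  have h2 : 0 < (p : ℝ) := by exact_mod_cast (Fact.out : p.Prime).pos
  positivity

lemma piDist_ge (i : ZMod p) : 1 / (p : ℝ) ^ 2 ≤ piDist p i := by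
  unfold piDist
  split_ifs with h
  · exact le_rfl
  · gcongr
    simp

lemma piDist_sum : ∑ i : ZMod p, piDist p i = 1 := by
  have h2 : 0 < (p : ℝ) := by exact_mod_cast (Fact.out : p.Prime).pos
  rw [← Finset.add_sum_erase _ _ (Finset.mem_univ (0 : ZMod p))]
  have : ∀ k ∈ (Finset.univ : Finset (ZMod p)).erase 0,
      piDist p k = ((p : ℝ) + 1) / (p : ℝ) ^ 2 := by
    intro k hk
    simp [piDist, (Finset.mem_erase.1 hk).1]
  rw [Finset.sum_congr rfl this, Finset.sum_const, Finset.card_erase_of_mem (Finset.mem_univ _),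
    Finset.card_univ, ZMod.card, nsmul_eq_mul, Nat.cast_sub (Fact.out : p.Prime).one_le]
  simp only [piDist, if_true]
  field_simp
  push_cast
  ring

lemma Ncirc_symm (i j : ZMod p) : Ncirc p i 1 j = Ncirc p j 1 i := by
  have key : ∀ i j : ZMod p, Ncirc p i 1 j ≤ Ncirc p j 1 i := by
    intro i j
    unfold Ncirc
    apply Finset.card_le_card_of_injOn (fun ab => (ab.1 + ab.2, -ab.2))
    · rintro ⟨a, b⟩ h
      simp only [Finset.coe_filter, Finset.mem_product, Set.mem_setOf_eq] at h ⊢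
      obtain ⟨⟨h1, h2⟩, h3⟩ := h
      refine ⟨⟨h3, ?_⟩, by simpa using h1⟩
      rw [mem_circ] at h2 ⊢
      simpa using h2
    · rintro ⟨a, b⟩ _ ⟨c, d⟩ _ h
      simp only [Prod.mk.injEq, neg_inj] at h ⊢
      obtain ⟨h1, rfl⟩ := h
      exact ⟨add_right_cancel h1, rfl⟩
  exact le_antisymm (key i j) (key j i)

lemma Ncirc_sum (i : ZMod p) :
    ∑ j, Ncirc p i 1 j = (circ p i).card * (circ p 1).card := by
  rw [← Finset.card_product]
  have := Finset.card_eq_sum_card_fiberwise (s := circ p i ×ˢ circ p 1)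
      (t := (Finset.univ : Finset (ZMod p)))
      (f := fun ab => (ab.1 + ab.2).1 ^ 2 + (ab.1 + ab.2).2 ^ 2)
      (by intro x _; simp)
  rw [this]
  simp only [Ncirc, mem_circ]

lemma kerA_sum (hp : p % 4 = 3) (i : ZMod p) : ∑ j, kerA p i j = 1 := by
  unfold kerA
  rw [← Finset.sum_div, ← Nat.cast_sum, Ncirc_sum, Nat.cast_mul]
  have h1 : 0 < ((circ p i).card : ℝ) := by exact_mod_cast card_pos hp i
  have h2 : 0 < ((circ p 1).card : ℝ) := by exact_mod_cast card_pos hp 1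
  field_simp

lemma kerA_nonneg (i j : ZMod p) : 0 ≤ kerA p i j := by
  unfold kerA
  positivity

lemma kerA_rev (hp : p % 4 = 3) (i j : ZMod p) :
    piDist p i * kerA p i j = piDist p j * kerA p j i := by
  rw [piDist_eq hp, piDist_eq hp]
  unfold kerA
  rw [Ncirc_symm j i]
  have h1 : 0 < ((circ p i).card : ℝ) := by exact_mod_cast card_pos hp i
  have h2 : 0 < ((circ p j).card : ℝ) := by exact_mod_cast card_pos hp j
  have h3 : 0 < ((circ p 1).card : ℝ) := by exact_mod_cast card_pos hp 1
  have h4 : 0 < (p : ℝ) := by exact_mod_cast (Fact.out : p.Prime).pos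
  field_simp

lemma card_sq_le (K : ZMod p) : ((Finset.univ : Finset (ZMod p)).filter (fun w => w ^ 2 = K)).card
    ≤ 2 := by
  by_cases h : ∃ w : ZMod p, w ^ 2 = K
  · obtain ⟨w, hw⟩ := h
    refine (Finset.card_le_card (t := {w, -w}) ?_).trans Finset.card_le_two
    intro x hx
    simp only [Finset.mem_filter, Finset.mem_univ, true_and] at hx
    simp only [Finset.mem_insert, Finset.mem_singleton]
    rw [← hw] at hx
    exact sq_eq_sq_iff_eq_or_eq_neg.1 hx
  · rw [Finset.filter_false_of_mem]
    · simp
    · intro x _ hx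
      exact h ⟨x, hx⟩

lemma fiber_le (hp : p % 4 = 3) (i j : ZMod p) (hi : i ≠ 0) (a : ZMod p × ZMod p)
    (ha : a ∈ circ p i) :
    ((circ p 1).filter (fun b => a + b ∈ circ p j)).card ≤ 2 := by
  have h2 : (2 : ZMod p) ≠ 0 := by
    intro h
    have h' : ((2 : ℕ) : ZMod p) = 0 := by exact_mod_cast h
    rw [ZMod.natCast_eq_zero_iff] at h'
    have := Nat.le_of_dvd (by norm_num) h'
    omega
  obtain ⟨x, y⟩ := a
  have ha' := (mem_circ _ _).1 ha
  simp only at ha'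
  refine le_trans ?_ (card_sq_le (i - ((j - i - 1) / 2) ^ 2))
  have hc : ∀ u v : ZMod p, (u, v) ∈ (circ p 1).filter (fun b => (x, y) + b ∈ circ p j) →
      x * u + y * v = (j - i - 1) / 2 ∧ u ^ 2 + v ^ 2 = 1 := by
    intro u v h
    simp only [Finset.mem_filter, mem_circ, Prod.mk_add_mk] at h
    obtain ⟨h3, h4⟩ := h
    refine ⟨?_, h3⟩
    field_simp
    linear_combination h4 - ha' - h3
  apply Finset.card_le_card_of_injOn (fun b => x * b.2 - y * b.1)
  · rintro ⟨u, v⟩ h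
    obtain ⟨h3, h4⟩ := hc u v h
    simp only [Finset.coe_filter, Finset.mem_univ, true_and, Set.mem_setOf_eq]
    rw [← h3, ← ha']
    linear_combination (x ^ 2 + y ^ 2) * h4
  · rintro ⟨u, v⟩ h ⟨u', v'⟩ h' hw
    obtain ⟨h3, h4⟩ := hc u v h
    obtain ⟨h3', h4'⟩ := hc u' v' h'
    simp only at hw
    have hab0 : x ^ 2 + y ^ 2 ≠ 0 := by rw [ha']; exact hi
    simp only [Prod.mk.injEq]
    constructor
    · apply mul_left_cancel₀ hab0
      linear_combination x * (h3 - h3') - y * hw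
    · apply mul_left_cancel₀ hab0
      linear_combination y * (h3 - h3') + x * hw

lemma Ncirc_le (hp : p % 4 = 3) (i j : ZMod p) (hi : i ≠ 0) :
    Ncirc p i 1 j ≤ (circ p i).card * 2 := by
  have : Ncirc p i 1 j = ∑ a ∈ circ p i, ((circ p 1).filter (fun b => a + b ∈ circ p j)).card := by
    unfold Ncirc
    simp_rw [Finset.card_filter]
    rw [Finset.sum_product]
  rw [this, ← smul_eq_mul]
  exact Finset.sum_le_card_nsmul _ _ _ (fun a ha => fiber_le hp i j hi a ha)

lemma Ncirc_zero_le (hp : p % 4 = 3) (i : ZMod p) : Ncirc p i 1 0 ≤ (circ p 1).card := by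
  rw [Ncirc_symm]
  calc Ncirc p 0 1 i ≤ (circ p 0 ×ˢ circ p 1).card := Finset.card_filter_le _ _
    _ = (circ p 1).card := by rw [Finset.card_product, circ_zero_card hp, one_mul]

lemma kerA_le (hp : p % 4 = 3) (i j : ZMod p) (hi : i ≠ 0) :
    kerA p i j ≤ 2 / ((p : ℝ) + 1) := by
  unfold kerA
  have h0 : (Ncirc p i 1 j : ℝ) ≤ ((circ p i).card : ℝ) * 2 := by
    exact_mod_cast Ncirc_le hp i j hi
  have h1 : 0 < ((circ p i).card : ℝ) := by exact_mod_cast card_pos hp i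
  have h2 : ((circ p 1).card : ℝ) = p + 1 := by
    rw [circ_card hp 1 one_ne_zero]; push_cast; rfl
  have h4 : 0 < (p : ℝ) + 1 := by positivity
  rw [h2, div_le_div_iff₀ (by positivity) h4]
  nlinarith

lemma kerA_zero_le (hp : p % 4 = 3) (i : ZMod p) (hi : i ≠ 0) :
    kerA p i 0 ≤ 1 / ((p : ℝ) + 1) := by
  unfold kerA
  have h0 : (Ncirc p i 1 0 : ℝ) ≤ ((circ p 1).card : ℝ) := by
    exact_mod_cast Ncirc_zero_le hp i
  have h1 : ((circ p i).card : ℝ) = p + 1 := by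
    rw [circ_card hp i hi]; push_cast; rfl
  have h2 : ((circ p 1).card : ℝ) = p + 1 := by
    rw [circ_card hp 1 one_ne_zero]; push_cast; rfl
  have h4 : 0 < (p : ℝ) + 1 := by positivity
  rw [h2] at h0 ⊢
  rw [h1, div_le_div_iff₀ (by positivity) h4]
  nlinarith

lemma kerA_zero_zero : kerA p 0 0 = 0 ∨ p % 4 ≠ 3 := by
  by_cases hp : p % 4 = 3
  · left
    have : Ncirc p 0 1 0 = 0 := by
      unfold Ncirc
      rw [Finset.card_eq_zero, Finset.filter_eq_empty_iff]
      rintro ⟨⟨x, y⟩, ⟨u, v⟩⟩ h h3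
      simp only [Finset.mem_product, mem_circ, Prod.mk_add_mk] at h h3
      obtain ⟨rfl, rfl⟩ := sq_add_sq_zero hp _ _ h.1
      simp only [zero_add] at h3
      rw [h.2] at h3
      exact one_ne_zero h3
    simp [kerA, this]
  · exact Or.inr hp

lemma trace_le (hp : p % 4 = 3) :
    ∑ i, ∑ j, kerA p i j * kerA p j i ≤ 2 * (p : ℝ) / ((p : ℝ) + 1) := by
  have h4 : 0 < (p : ℝ) + 1 := by positivity
  have h00 : kerA p 0 0 = 0 := kerA_zero_zero.resolve_right (fun h => h hp)
  have row0 : ∑ j, kerA p 0 j * kerA p j 0 ≤ 1 / ((p : ℝ) + 1) := by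
    calc ∑ j, kerA p 0 j * kerA p j 0 ≤ ∑ j, kerA p 0 j * (1 / ((p : ℝ) + 1)) := by
          refine Finset.sum_le_sum fun j _ => ?_
          by_cases hj : j = 0
          · subst hj
            simp [h00]
          · exact mul_le_mul_of_nonneg_left (kerA_zero_le hp j hj) (kerA_nonneg _ _)
      _ = 1 / ((p : ℝ) + 1) := by rw [← Finset.sum_mul, kerA_sum hp, one_mul]
  have rowi : ∀ i ∈ (Finset.univ : Finset (ZMod p)).erase 0,
      ∑ j, kerA p i j * kerA p j i ≤ kerA p 0 i * kerA p i 0 + 2 / ((p : ℝ) + 1) := by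
    intro i hi
    rw [← Finset.add_sum_erase _ _ (Finset.mem_univ (0 : ZMod p)), mul_comm (kerA p i 0)]
    gcongr
    calc ∑ j ∈ Finset.univ.erase 0, kerA p i j * kerA p j i
        ≤ ∑ j ∈ Finset.univ.erase 0, kerA p i j * (2 / ((p : ℝ) + 1)) := by
          refine Finset.sum_le_sum fun j hj => ?_
          exact mul_le_mul_of_nonneg_left (kerA_le hp j i (Finset.mem_erase.1 hj).1)
            (kerA_nonneg _ _)
      _ ≤ ∑ j, kerA p i j * (2 / ((p : ℝ) + 1)) := by
          refine Finset.sum_le_sum_of_subset_of_nonneg (Finset.erase_subset _ _) ?_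
          intro j _ _
          have := kerA_nonneg i j
          positivity
      _ = 2 / ((p : ℝ) + 1) := by rw [← Finset.sum_mul, kerA_sum hp, one_mul]
  have rest : ∑ i ∈ (Finset.univ : Finset (ZMod p)).erase 0, kerA p 0 i * kerA p i 0
      = ∑ j, kerA p 0 j * kerA p j 0 := by
    rw [← Finset.add_sum_erase _ _ (Finset.mem_univ (0 : ZMod p)), h00]
    simp
  rw [← Finset.add_sum_erase _ _ (Finset.mem_univ (0 : ZMod p))]
  have := Finset.sum_le_sum rowi
  rw [Finset.sum_add_distrib, rest, Finset.sum_const,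
    Finset.card_erase_of_mem (Finset.mem_univ _),
    Finset.card_univ, ZMod.card, nsmul_eq_mul, Nat.cast_sub (Fact.out : p.Prime).one_le] at this
  have e : 2 * (p : ℝ) / ((p : ℝ) + 1)
      = 1 / ((p : ℝ) + 1) + (1 / ((p : ℝ) + 1) + ((p : ℝ) - 1) * (2 / ((p : ℝ) + 1))) := by
    field_simp
    ring
  rw [e]
  push_cast at this
  linarith

/-- The projector onto the stationary distribution. -/
noncomputable def piM (p : ℕ) [NeZero p] : Matrix (ZMod p) (ZMod p) ℝ := fun _ j => piDist p j

lemma hs_le (hp : p % 4 = 3) :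
    hsW (piDist p) (kerA p - piM p) ≤ 1 - 2 / ((p : ℝ) + 1) := by
  have h4 : 0 < (p : ℝ) + 1 := by positivity
  have e : hsW (piDist p) (kerA p - piM p)
      = ∑ i, ∑ j, (kerA p i j * kerA p j i - 2 * (piDist p i * kerA p i j)
        + piDist p i * piDist p j) := by
    unfold hsW
    refine Finset.sum_congr rfl fun i _ => Finset.sum_congr rfl fun j _ => ?_
    have hj := (piDist_pos hp j).ne'
    have hr := kerA_rev hp i j
    simp only [Matrix.sub_apply, piM]
    field_simp
    linear_combination kerA p i j * hr
  have e2 : ∑ i, ∑ j, (kerA p i j * kerA p j i - 2 * (piDist p i * kerA p i j)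
        + piDist p i * piDist p j) = ∑ i, ∑ j, kerA p i j * kerA p j i - 1 := by
    simp_rw [Finset.sum_add_distrib, Finset.sum_sub_distrib, ← Finset.mul_sum, kerA_sum hp,
      piDist_sum, mul_one, piDist_sum]
    ring
  rw [e, e2]
  have := trace_le hp
  have e3 : 2 * (p : ℝ) / ((p : ℝ) + 1) = 2 - 2 / ((p : ℝ) + 1) := by
    field_simp
    ring
  linarith

lemma pow_eq (hp : p % 4 = 3) (t : ℕ) :
    (kerA p - piM p) ^ (t + 1) = kerA p ^ (t + 1) - piM p := by
  apply pow_sub_proj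
  · ext i j
    simp only [Matrix.mul_apply, piM]
    rw [← Finset.sum_mul, kerA_sum hp, one_mul]
  · ext i j
    simp only [Matrix.mul_apply, piM]
    simp_rw [kerA_rev hp _ j]
    rw [← Finset.mul_sum, kerA_sum hp, mul_one]
  · ext i j
    simp only [Matrix.mul_apply, piM]
    rw [← Finset.sum_mul, piDist_sum, one_mul]

lemma main_bound (hp : p % 4 = 3) (t : ℕ) (i : ZMod p) :
    (∑ j, |(kerA p ^ (t + 1)) i j - piDist p j|) ^ 2
      ≤ (p : ℝ) ^ 2 * Real.exp (-(2 / ((p : ℝ) + 1))) ^ (t + 1) := by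
  have h4 : 0 < (p : ℝ) := by exact_mod_cast (Fact.out : p.Prime).pos
  have h1 := row_le (piDist p) (piDist_pos hp) piDist_sum ((kerA p - piM p) ^ (t + 1)) i
  have h2 := hsW_pow (piDist p) (piDist_pos hp) (kerA p - piM p) t
  have h3 : hsW (piDist p) (kerA p - piM p) ^ (t + 1)
      ≤ Real.exp (-(2 / ((p : ℝ) + 1))) ^ (t + 1) := by
    apply pow_le_pow_left₀ (hsW_nonneg _ (piDist_pos hp) _)
    refine (hs_le hp).trans ?_
    have := Real.add_one_le_exp (-(2 / ((p : ℝ) + 1)))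
    linarith
  have h5 := (h1.trans h2).trans h3
  rw [pow_eq hp] at h5
  simp only [Matrix.sub_apply, piM] at h5
  set S := ∑ j, |(kerA p ^ (t + 1)) i j - piDist p j|
  have h6 : 1 / (p : ℝ) ^ 2 * S ^ 2 ≤ piDist p i * S ^ 2 :=
    mul_le_mul_of_nonneg_right (piDist_ge i) (sq_nonneg _)
  have h7 := h6.trans h5
  calc S ^ 2 = (p : ℝ) ^ 2 * (1 / (p : ℝ) ^ 2 * S ^ 2) := by field_simp
    _ ≤ _ := mul_le_mul_of_nonneg_left h7 (by positivity)

end Circle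

/-- the mixing time of the random walk by the unit circle is `O(p·ln p)`. -/
theorem mixing_time_p_log_p :
    ∃ C : ℝ, 0 < C ∧ ∀ (p : ℕ) [Fact p.Prime], p % 4 = 3 →
      ∀ t : ℕ, C * (p : ℝ) * Real.log (p : ℝ) ≤ (t : ℝ) → ∀ i : ZMod p,
        (1 / 2) * ∑ j : ZMod p, |(kerA p ^ t) i j - piDist p j|
          ≤ 1 / (2 * Real.exp 1) := by
  refine ⟨4, by norm_num, ?_⟩
  intro p _ hp t ht i
  have hp3 : (3 : ℝ) ≤ p := by
    have : 3 ≤ p := by omega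
    exact_mod_cast this
  have hlog : 1 ≤ Real.log p := by
    rw [Real.le_log_iff_exp_le (by linarith)]
    have := Real.exp_one_lt_d9
    linarith
  have htpos : 0 < (t : ℝ) := by nlinarith
  obtain ⟨n, rfl⟩ : ∃ n, t = n + 1 := ⟨t - 1, by
    have : 0 < t := by exact_mod_cast htpos
    omega⟩
  have hb := main_bound hp n i
  set S := ∑ j, |(kerA p ^ (n + 1)) i j - piDist p j| with hS
  have hE : (p : ℝ) ^ 2 * Real.exp (-(2 / ((p : ℝ) + 1))) ^ (n + 1) ≤ (Real.exp (-1)) ^ 2 := by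
    have hpe : (p : ℝ) = Real.exp (Real.log p) := (Real.exp_log (by linarith)).symm
    have h1 : (p : ℝ) ^ 2 = Real.exp (2 * Real.log p) := by
      conv_lhs => rw [hpe]
      rw [← Real.exp_nat_mul]
      norm_num
    rw [h1, ← Real.exp_nat_mul, ← Real.exp_nat_mul, ← Real.exp_add, Real.exp_le_exp]
    have h2 : (2 * Real.log p + 2) * ((p : ℝ) + 1) ≤ 2 * ((n + 1 : ℕ) : ℝ) := by nlinarith
    have h3 : 2 * Real.log p + 2 ≤ ((n + 1 : ℕ) : ℝ) * (2 / ((p : ℝ) + 1)) := by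
      rw [mul_div_assoc', le_div_iff₀ (by linarith)]
      linarith
    push_cast at h3 ⊢
    linarith
  have hfin : S ≤ Real.exp (-1) :=
    le_of_abs_le (abs_le_of_sq_le_sq (hb.trans hE) (Real.exp_pos _).le)
  rw [Real.exp_neg] at hfin
  calc (1 / 2) * S ≤ (1 / 2) * (Real.exp 1)⁻¹ := by linarith
    _ = 1 / (2 * Real.exp 1) := by
      have := Real.exp_pos 1
      field_simp
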